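/- Let X = Y + Z where Y ∈ ℝ^{n×d} has rank k, and the row space of Y is orthogonal to the row space of Z. Let V span the top-k right singular subspace of Y and V̂ span the top-k right singular subspace of X. If σ_k(Y)² ≥ 2‖Z‖², then ‖Π_V − Π_{V̂}‖ ≤ 4‖Z‖/σ_k(Y), where ‖·‖ is the spectral norm and Π_W denotes orthogonal projection onto the subspace W. -/

import Mathlib

open MeasureTheory Finset
open scoped RealInnerProductSpace

noncomputable section
open Classical

/-- Frobenius norm of a real matrix. -/
def frobNorm {I J : Type*} [Fintype I] [Fintype J] (A : Matrix I J ℝ) : ℝ :=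
  Real.sqrt (∑ i, ∑ j, (A i j) ^ 2)

/-- Euclidean norm of a vector in `ℝ^d`. -/
def norm2 {I : Type*} [Fintype I] (v : I → ℝ) : ℝ := Real.sqrt (∑ j, (v j) ^ 2)

/-- Spectral (operator) norm of a real matrix. -/
def specNorm {I : Type*} [Fintype I] {d : ℕ} (A : Matrix I (Fin d) ℝ) : ℝ :=
  sSup {s | ∃ v : Fin d → ℝ, norm2 v = 1 ∧ s = norm2 (A.mulVec v)}

/-- `singVal A k` is the `k`-th largest singular value of `A` (1-based),
via the Courant–Fischer min-max principle. -/
def singVal {I : Type*} [Fintype I] {d : ℕ} (A : Matrix I (Fin d) ℝ) (k : ℕ) : ℝ :=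
  sSup {r | ∃ E : Submodule ℝ (Fin d → ℝ), Module.finrank ℝ E = k ∧
    r = sInf {s | ∃ v ∈ E, norm2 v = 1 ∧ s = norm2 (A.mulVec v)}}

/-- `P` is a `d × d` orthogonal projection matrix of rank `k`. -/
def IsProjOfRank {d : ℕ} (P : Matrix (Fin d) (Fin d) ℝ) (k : ℕ) : Prop :=
  P.transpose = P ∧ P * P = P ∧ P.rank = k

/-- `P` is an orthogonal projection onto a top-`k` right-singular (row) subspace of `A`:
it is a rank-`k` orthogonal projection maximizing `‖A P'‖_F` among rank-`k` projections. -/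
def IsTopKProj {I : Type*} [Fintype I] {d : ℕ} (A : Matrix I (Fin d) ℝ) (k : ℕ)
    (P : Matrix (Fin d) (Fin d) ℝ) : Prop :=
  IsProjOfRank P k ∧ ∀ P', IsProjOfRank P' k → frobNorm (A * P') ≤ frobNorm (A * P)

open Matrix

section Norm

variable {I : Type*} [Fintype I]

theorem norm2_eq_norm (v : I → ℝ) : norm2 v = ‖WithLp.toLp 2 v‖ := by
  simp [norm2, EuclideanSpace.norm_eq]

theorem norm2_nonneg (v : I → ℝ) : 0 ≤ norm2 v := Real.sqrt_nonneg _

theorem norm2_sub_le (v w : I → ℝ) : norm2 (v - w) ≤ norm2 v + norm2 w := by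
  simpa [norm2_eq_norm] using norm_sub_le (WithLp.toLp 2 v) (WithLp.toLp 2 w)

theorem norm2_smul (c : ℝ) (v : I → ℝ) : norm2 (c • v) = |c| * norm2 v := by
  simp [norm2_eq_norm, norm_smul]

theorem norm2_sq (v : I → ℝ) : norm2 v ^ 2 = v ⬝ᵥ v := by
  rw [norm2, Real.sq_sqrt (by positivity)]
  simp [dotProduct, sq]

theorem dotProduct_le_norm2_mul_norm2 (v w : I → ℝ) : v ⬝ᵥ w ≤ norm2 v * norm2 w := by
  simpa [norm2_eq_norm, EuclideanSpace.inner_eq_star_dotProduct, dotProduct_comm] using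
    real_inner_le_norm (WithLp.toLp 2 v) (WithLp.toLp 2 w)

theorem dotProduct_self_nonneg (v : I → ℝ) : 0 ≤ v ⬝ᵥ v := by
  rw [← norm2_sq]; positivity

theorem norm2_eq_zero {v : I → ℝ} : norm2 v = 0 ↔ v = 0 := by
  simp [norm2_eq_norm]

theorem dotProduct_self_pos {v : I → ℝ} (hv : v ≠ 0) : 0 < v ⬝ᵥ v :=
  (dotProduct_self_nonneg v).lt_of_ne' (by simpa using hv)

theorem norm2_inv_smul {v : I → ℝ} (hv : v ≠ 0) : norm2 ((norm2 v)⁻¹ • v) = 1 := by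
  rw [norm2_smul, abs_of_nonneg (inv_nonneg.2 (norm2_nonneg v)),
    inv_mul_cancel₀ (mt norm2_eq_zero.1 hv)]

variable {d : ℕ}

theorem norm2_mulVec_le_frobNorm (A : Matrix I (Fin d) ℝ) (v : Fin d → ℝ) :
    norm2 (A *ᵥ v) ≤ frobNorm A * norm2 v := by
  rw [norm2, frobNorm, norm2, ← Real.sqrt_mul (by positivity), Finset.sum_mul]
  gcongr with i
  exact Finset.sum_mul_sq_le_sq_mul_sq Finset.univ (A i) v

theorem norm2_mulVec_le_specNorm (A : Matrix I (Fin d) ℝ) (v : Fin d → ℝ) :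
    norm2 (A *ᵥ v) ≤ specNorm A * norm2 v := by
  obtain rfl | hv := eq_or_ne v 0
  · simp [norm2]
  have hpos : 0 < norm2 v := (norm2_nonneg v).lt_of_ne' (mt norm2_eq_zero.1 hv)
  have h : norm2 (A *ᵥ ((norm2 v)⁻¹ • v)) ≤ specNorm A := by
    refine le_csSup ⟨frobNorm A, ?_⟩ ⟨_, norm2_inv_smul hv, rfl⟩
    rintro _ ⟨w, hw, rfl⟩
    simpa [hw] using norm2_mulVec_le_frobNorm A w
  rwa [mulVec_smul, norm2_smul, abs_of_nonneg (inv_nonneg.2 hpos.le), inv_mul_le_iff₀ hpos,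
    mul_comm] at h

theorem specNorm_nonneg (A : Matrix I (Fin d) ℝ) : 0 ≤ specNorm A :=
  Real.sSup_nonneg (by rintro _ ⟨v, -, rfl⟩; exact norm2_nonneg _)

theorem specNorm_le {A : Matrix I (Fin d) ℝ} {C : ℝ} (hC : 0 ≤ C)
    (h : ∀ v, norm2 v = 1 → norm2 (A *ᵥ v) ≤ C) : specNorm A ≤ C :=
  Real.sSup_le (by rintro _ ⟨v, hv, rfl⟩; exact h v hv) hC

theorem singVal_nonneg (A : Matrix I (Fin d) ℝ) (k : ℕ) : 0 ≤ singVal A k := by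
  refine Real.sSup_nonneg ?_
  rintro _ ⟨E, -, rfl⟩
  refine Real.sInf_nonneg ?_
  rintro _ ⟨v, -, -, rfl⟩
  exact norm2_nonneg _

theorem frobNorm_sq (A : Matrix I (Fin d) ℝ) : frobNorm A ^ 2 = (A * Aᵀ).trace := by
  rw [frobNorm, Real.sq_sqrt (by positivity)]
  simp [Matrix.trace, Matrix.mul_apply, sq]

theorem frobNorm_nonneg (A : Matrix I (Fin d) ℝ) : 0 ≤ frobNorm A := Real.sqrt_nonneg _

end Norm

section Projection

variable {d k : ℕ} {P Q : Matrix (Fin d) (Fin d) ℝ}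

theorem dotProduct_mulVec_of_transpose_eq (hP : Pᵀ = P) (v w : Fin d → ℝ) :
    v ⬝ᵥ P *ᵥ w = P *ᵥ v ⬝ᵥ w := by
  rw [dotProduct_mulVec, ← mulVec_transpose, hP]

theorem trace_eq_rank_of_mul_self (hP : P * P = P) : P.trace = P.rank := by
  have h : LinearMap.IsProj (LinearMap.range P.mulVecLin) P.mulVecLin := by
    refine ⟨fun x => ⟨x, rfl⟩, ?_⟩
    rintro _ ⟨x, rfl⟩
    simp [hP]
  have := h.trace
  rw [Matrix.rank, ← this]
  exact (Matrix.trace_toLin'_eq P).symm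

theorem isProjOfRank_iff_trace :
    IsProjOfRank P k ↔ Pᵀ = P ∧ P * P = P ∧ P.trace = k := by
  refine and_congr_right fun _ => and_congr_right fun h => ?_
  rw [trace_eq_rank_of_mul_self h]
  exact Nat.cast_inj.symm

theorem IsProjOfRank.mulVec_mulVec (hP : IsProjOfRank P k) (v : Fin d → ℝ) :
    P *ᵥ P *ᵥ v = P *ᵥ v := by
  rw [Matrix.mulVec_mulVec, hP.2.1]

theorem IsProjOfRank.dotProduct_eq_zero (hP : IsProjOfRank P k) {u w : Fin d → ℝ}
    (hu : P *ᵥ u = u) (hw : P *ᵥ w = 0) : u ⬝ᵥ w = 0 := by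
  rw [← hu, ← dotProduct_mulVec_of_transpose_eq hP.1, hw, dotProduct_zero]

theorem IsProjOfRank.norm2_mulVec_le (hP : IsProjOfRank P k) (v : Fin d → ℝ) :
    norm2 (P *ᵥ v) ≤ norm2 v := by
  have h : norm2 (P *ᵥ v) ^ 2 ≤ norm2 (P *ᵥ v) * norm2 v := by
    rw [norm2_sq, ← dotProduct_mulVec_of_transpose_eq hP.1, hP.mulVec_mulVec,
      dotProduct_comm]
    exact dotProduct_le_norm2_mul_norm2 _ _
  nlinarith [norm2_nonneg v, norm2_nonneg (P *ᵥ v)]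

theorem IsProjOfRank.rank_one_exchange (hQ : IsProjOfRank Q k) {u t : Fin d → ℝ}
    (hu : Q *ᵥ u = u) (hu0 : u ≠ 0) (ht0 : t ≠ 0)
    (ht : (u ⬝ᵥ u) • Q *ᵥ t = (u ⬝ᵥ t) • u) :
    IsProjOfRank (Q - (u ⬝ᵥ u)⁻¹ • vecMulVec u u + (t ⬝ᵥ t)⁻¹ • vecMulVec t t) k := by
  have hU : u ⬝ᵥ u ≠ 0 := by simpa using hu0
  have hT : t ⬝ᵥ t ≠ 0 := by simpa using ht0
  have hQt : Q *ᵥ t = ((u ⬝ᵥ u)⁻¹ * (u ⬝ᵥ t)) • u := by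
    rw [mul_smul, ← ht, inv_smul_smul₀ hU]
  obtain ⟨h1, h2, h3⟩ := isProjOfRank_iff_trace.1 hQ
  have hvQ : ∀ x, x ᵥ* Q = Q *ᵥ x := fun x => by rw [← mulVec_transpose, h1]
  rw [isProjOfRank_iff_trace]
  refine ⟨?_, ?_, ?_⟩
  · simp [h1]
  · simp only [mul_add, add_mul, mul_sub, sub_mul, h2, Matrix.mul_smul, Matrix.smul_mul,
      mul_vecMulVec, vecMulVec_mul, hvQ, hu, hQt, smul_vecMulVec, vecMulVec_smul]
    ext i j
    simp [vecMulVec_apply, smul_mulVec, vecMulVec_mulVec, dotProduct_comm t u]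
    field_simp
    ring
  · simp [h3, trace_vecMulVec, hU, hT]


theorem Matrix.rank_add_finrank_ker {J : Type*} (A : Matrix J (Fin d) ℝ) :
    A.rank + Module.finrank ℝ (LinearMap.ker A.mulVecLin) = d := by
  simpa [Matrix.rank] using LinearMap.finrank_range_add_finrank_ker A.mulVecLin

theorem exists_isProjOfRank_mul_eq_self {J : Type*} (A : Matrix J (Fin d) ℝ) :
    ∃ P : Matrix (Fin d) (Fin d) ℝ, IsProjOfRank P A.rank ∧ A * P = A := by
  set K := (LinearMap.ker (toEuclideanLin A))ᗮ
  have hKo : Kᗮ = LinearMap.ker (toEuclideanLin A) := Submodule.orthogonal_orthogonal _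
  set P := (toEuclideanCLM (n := Fin d) (𝕜 := ℝ)).symm K.starProjection with hPdef
  have hPv : ∀ v, WithLp.toLp 2 (P *ᵥ v) = K.starProjection (WithLp.toLp 2 v) := by
    intro v
    rw [← toEuclideanCLM_toLp, hPdef, StarAlgEquiv.apply_symm_apply]
  have hAP : A * P = A := by
    refine Matrix.ext_of_mulVec_single fun i => ?_
    generalize (Pi.single i 1 : Fin d → ℝ) = v
    have h : WithLp.toLp 2 v - K.starProjection (WithLp.toLp 2 v) ∈ Kᗮ :=
      Submodule.sub_starProjection_mem_orthogonal _
    rw [hKo, ← hPv, ← WithLp.toLp_sub] at h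
    have h' : A *ᵥ (v - P *ᵥ v) = 0 := congrArg WithLp.ofLp (LinearMap.mem_ker.1 h)
    rw [mulVec_sub, sub_eq_zero] at h'
    rw [← Matrix.mulVec_mulVec, h']
  have hker : LinearMap.ker A.mulVecLin ≤ LinearMap.ker P.mulVecLin := by
    intro v hv
    have h : WithLp.toLp 2 v ∈ Kᗮ := by
      rw [hKo]
      simpa using hv
    have := hPv v
    rw [(Submodule.starProjection_apply_eq_zero_iff K).2 h] at this
    simpa using this
  refine ⟨P, ⟨?_, ?_, ?_⟩, hAP⟩
  · have : star P = P := by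
      have h := (toEuclideanCLM (n := Fin d) (𝕜 := ℝ)).symm.map_star' K.starProjection
      rw [(isSelfAdjoint_starProjection K).star_eq] at h
      exact h.symm
    rwa [star_eq_conjTranspose, conjTranspose_eq_transpose_of_trivial] at this
  · rw [hPdef, ← map_mul, K.isIdempotentElem_starProjection.eq]
  · apply le_antisymm
    · have := Submodule.finrank_mono hker
      have := A.rank_add_finrank_ker
      have := P.rank_add_finrank_ker
      omega
    · conv_lhs => rw [← hAP]
      exact rank_mul_le_right A P

variable {I : Type*} [Fintype I] {A : Matrix I (Fin d) ℝ}

theorem IsProjOfRank.frobNorm_mul_sq (hP : IsProjOfRank P k) :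
    frobNorm (A * P) ^ 2 = (A * P * Aᵀ).trace := by
  rw [frobNorm_sq, transpose_mul, hP.1, ← Matrix.mul_assoc, Matrix.mul_assoc A, hP.2.1]

theorem IsTopKProj.trace_le (hQ : IsTopKProj A k Q) (hP : IsProjOfRank P k) :
    (A * P * Aᵀ).trace ≤ (A * Q * Aᵀ).trace := by
  have h : frobNorm (A * P) ≤ frobNorm (A * Q) := hQ.2 P hP
  rw [← hP.frobNorm_mul_sq, ← hQ.1.frobNorm_mul_sq]
  exact pow_le_pow_left₀ (frobNorm_nonneg _) h 2

theorem trace_mul_vecMulVec_mul_transpose (u : Fin d → ℝ) :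
    (A * vecMulVec u u * Aᵀ).trace = A *ᵥ u ⬝ᵥ A *ᵥ u := by
  rw [mul_vecMulVec, vecMulVec_mul, vecMul_transpose, trace_vecMulVec]

theorem IsTopKProj.rayleigh_le (hQ : IsTopKProj A k Q) {u w : Fin d → ℝ}
    (hu : Q *ᵥ u = u) (hw : Q *ᵥ w = 0) :
    (A *ᵥ (u + w) ⬝ᵥ A *ᵥ (u + w)) * (u ⬝ᵥ u) ≤
      (A *ᵥ u ⬝ᵥ A *ᵥ u) * (u ⬝ᵥ u + w ⬝ᵥ w) := by
  obtain rfl | hu0 := eq_or_ne u 0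
  · simp
  have huw : u ⬝ᵥ w = 0 := hQ.1.dotProduct_eq_zero hu hw
  have hQt : Q *ᵥ (u + w) = u := by rw [mulVec_add, hu, hw, add_zero]
  have ht0 : u + w ≠ 0 := by
    intro h
    rw [h, mulVec_zero] at hQt
    exact hu0 hQt.symm
  have hU : 0 < u ⬝ᵥ u := dotProduct_self_pos hu0
  have hT : (u + w) ⬝ᵥ (u + w) = u ⬝ᵥ u + w ⬝ᵥ w := by
    simp [add_dotProduct, dotProduct_add, huw, dotProduct_comm w u]
  have hTpos : 0 < u ⬝ᵥ u + w ⬝ᵥ w := by linarith [dotProduct_self_nonneg w]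
  have hex := hQ.1.rank_one_exchange hu hu0 ht0 (by rw [hQt, dotProduct_add, huw, add_zero])
  have hle := hQ.trace_le hex
  simp only [Matrix.mul_add, Matrix.mul_sub, Matrix.add_mul, Matrix.sub_mul, Matrix.mul_smul,
    Matrix.smul_mul, trace_add, trace_sub, trace_smul, trace_mul_vecMulVec_mul_transpose,
    smul_eq_mul, hT] at hle
  have h : (u ⬝ᵥ u + w ⬝ᵥ w)⁻¹ * (A *ᵥ (u + w) ⬝ᵥ A *ᵥ (u + w)) ≤
      (u ⬝ᵥ u)⁻¹ * (A *ᵥ u ⬝ᵥ A *ᵥ u) := by linarith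
  rw [inv_mul_eq_div, inv_mul_eq_div, div_le_div_iff₀ hTpos hU] at h
  exact h

theorem IsTopKProj.mulVec_dotProduct_mulVec_eq_zero (hQ : IsTopKProj A k Q) {u w : Fin d → ℝ}
    (hu : Q *ᵥ u = u) (hw : Q *ᵥ w = 0) : A *ᵥ u ⬝ᵥ A *ᵥ w = 0 := by
  obtain rfl | hu0 := eq_or_ne u 0
  · simp
  have hU : 0 < u ⬝ᵥ u := dotProduct_self_pos hu0
  have h : ∀ ε : ℝ, 2 * ε * (A *ᵥ u ⬝ᵥ A *ᵥ w) * (u ⬝ᵥ u) + ε ^ 2 *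
      ((A *ᵥ w ⬝ᵥ A *ᵥ w) * (u ⬝ᵥ u) - (A *ᵥ u ⬝ᵥ A *ᵥ u) * (w ⬝ᵥ w)) ≤ 0 := by
    intro ε
    have := hQ.rayleigh_le hu (w := ε • w) (by rw [mulVec_smul, hw, smul_zero])
    simp only [mulVec_add, mulVec_smul, add_dotProduct, dotProduct_add, smul_dotProduct,
      dotProduct_smul, smul_eq_mul, dotProduct_comm (A *ᵥ w) (A *ᵥ u)] at this
    linarith
  generalize (A *ᵥ w ⬝ᵥ A *ᵥ w) * (u ⬝ᵥ u) - (A *ᵥ u ⬝ᵥ A *ᵥ u) * (w ⬝ᵥ w) = c at h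
  generalize A *ᵥ u ⬝ᵥ A *ᵥ w = b at h ⊢
  have hb : (b * (u ⬝ᵥ u)) ^ 2 ≤ 0 := by
    have := h (b * (u ⬝ᵥ u) / (|c| + 1))
    have hc : 0 < |c| + 1 := by positivity
    field_simp at this
    have hsq := sq_nonneg (b * (u ⬝ᵥ u))
    have hcc : 0 ≤ |c| + c := by linarith [neg_abs_le c]
    nlinarith [mul_nonneg hsq hcc, mul_nonneg hsq (abs_nonneg c)]
  have := pow_eq_zero_iff two_ne_zero |>.1 (le_antisymm hb (sq_nonneg _))
  exact (mul_eq_zero.1 this).resolve_right hU.ne'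

theorem IsTopKProj.mulVec_dotProduct_self_mul_le (hQ : IsTopKProj A k Q) {u w : Fin d → ℝ}
    (hu : Q *ᵥ u = u) (hw : Q *ᵥ w = 0) :
    (A *ᵥ w ⬝ᵥ A *ᵥ w) * (u ⬝ᵥ u) ≤ (A *ᵥ u ⬝ᵥ A *ᵥ u) * (w ⬝ᵥ w) := by
  have h := hQ.rayleigh_le hu hw
  have h0 := hQ.mulVec_dotProduct_mulVec_eq_zero hu hw
  simp only [mulVec_add, add_dotProduct, dotProduct_add, h0,
    dotProduct_comm (A *ᵥ w) (A *ᵥ u)] at h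
  linarith


theorem IsTopKProj.mul_eq_self (hP : IsTopKProj A k P) (hA : A.rank = k) : A * P = A := by
  obtain ⟨R, hR, hAR⟩ := exists_isProjOfRank_mul_eq_self A
  have hle := hP.trace_le (hA ▸ hR)
  rw [hAR] at hle
  have h : ((A - A * P) * (A - A * P)ᵀ).trace = (A * Aᵀ).trace - (A * P * Aᵀ).trace := by
    rw [← trace_sub, transpose_sub, transpose_mul, hP.1.1, Matrix.sub_mul, Matrix.mul_sub,
      Matrix.mul_sub, ← Matrix.mul_assoc, ← Matrix.mul_assoc, Matrix.mul_assoc A P P, hP.1.2.1]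
    abel_nf
  have h0 : ((A - A * P) * (A - A * P)ᴴ).trace = 0 := by
    rw [conjTranspose_eq_transpose_of_trivial]
    refine le_antisymm (by linarith) ?_
    rw [← frobNorm_sq]
    positivity
  exact (sub_eq_zero.1 (trace_mul_conjTranspose_self_eq_zero_iff.1 h0)).symm

theorem IsTopKProj.mulVec_eq_zero_iff (hP : IsTopKProj A k P) (hA : A.rank = k)
    (v : Fin d → ℝ) : P *ᵥ v = 0 ↔ A *ᵥ v = 0 := by
  have hle : LinearMap.ker P.mulVecLin ≤ LinearMap.ker A.mulVecLin := by
    intro v hv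
    have hv' : P *ᵥ v = 0 := hv
    rw [LinearMap.mem_ker, mulVecLin_apply, ← hP.mul_eq_self hA, ← Matrix.mulVec_mulVec, hv',
      mulVec_zero]
  have heq : LinearMap.ker P.mulVecLin = LinearMap.ker A.mulVecLin := by
    refine Submodule.eq_of_le_of_finrank_eq hle ?_
    have := A.rank_add_finrank_ker
    have := P.rank_add_finrank_ker
    have := hP.1.2.2
    omega
  exact SetLike.ext_iff.1 heq v

theorem IsProjOfRank.mul_eq_of_ker_le {l : ℕ} (hQ : IsProjOfRank Q l)
    (h : ∀ v, Q *ᵥ v = 0 → P *ᵥ v = 0) : P * Q = P := by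
  refine Matrix.ext_of_mulVec_single fun i => ?_
  generalize (Pi.single i 1 : Fin d → ℝ) = v
  have := h (v - Q *ᵥ v) (by rw [mulVec_sub, hQ.mulVec_mulVec, sub_self])
  rw [mulVec_sub, sub_eq_zero] at this
  rw [← Matrix.mulVec_mulVec, this]

theorem IsProjOfRank.eq_of_mulVec_eq_zero_iff {l : ℕ} (hP : IsProjOfRank P k)
    (hQ : IsProjOfRank Q l) (h : ∀ v, P *ᵥ v = 0 ↔ Q *ᵥ v = 0) : P = Q := by
  have h1 := hQ.mul_eq_of_ker_le fun v => (h v).2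
  have h2 := hP.mul_eq_of_ker_le fun v => (h v).1
  rw [← hP.1, ← h1, transpose_mul, hP.1, hQ.1, h2]

theorem exists_smul_add_mem_ne_zero {S T : Submodule ℝ (Fin d → ℝ)} {v : Fin d → ℝ}
    (hv : v ∉ S) (h : d ≤ Module.finrank ℝ S + Module.finrank ℝ T) :
    ∃ a : ℝ, ∃ s ∈ S, a • v + s ∈ T ∧ a • v + s ≠ 0 := by
  have hlt : Module.finrank ℝ S < Module.finrank ℝ ↥(ℝ ∙ v ⊔ S) := by
    refine Submodule.finrank_lt_finrank_of_lt (lt_of_le_of_ne le_sup_right ?_)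
    intro heq
    exact hv (heq ▸ Submodule.mem_sup_left (Submodule.mem_span_singleton_self v))
  have hsum := Submodule.finrank_sup_add_finrank_inf_eq (ℝ ∙ v ⊔ S) T
  have hle := Submodule.finrank_le ((ℝ ∙ v ⊔ S) ⊔ T)
  rw [Module.finrank_fin_fun] at hle
  have hne : (ℝ ∙ v ⊔ S) ⊓ T ≠ ⊥ := by
    intro h0
    rw [h0, finrank_bot] at hsum
    omega
  obtain ⟨t, ⟨ht1, ht2⟩, ht0⟩ := Submodule.exists_mem_ne_zero_of_ne_bot hne
  obtain ⟨y, hy, s, hs, rfl⟩ := Submodule.mem_sup.1 ht1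
  obtain ⟨a, rfl⟩ := Submodule.mem_span_singleton.1 hy
  exact ⟨a, s, hs, ht2, ht0⟩

theorem IsProjOfRank.mem_range_iff (hP : IsProjOfRank P k) {v : Fin d → ℝ} :
    v ∈ LinearMap.range P.mulVecLin ↔ P *ᵥ v = v := by
  refine ⟨?_, fun h => ⟨v, h⟩⟩
  rintro ⟨w, rfl⟩
  exact hP.mulVec_mulVec w

theorem IsProjOfRank.finrank_range (hP : IsProjOfRank P k) :
    Module.finrank ℝ (LinearMap.range P.mulVecLin) = k := hP.2.2

theorem IsProjOfRank.finrank_ker (hP : IsProjOfRank P k) :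
    k + Module.finrank ℝ (LinearMap.ker P.mulVecLin) = d := by
  simpa only [hP.2.2] using P.rank_add_finrank_ker

theorem singVal_mul_norm2_le (hP : IsProjOfRank P k) (hker : ∀ v, P *ᵥ v = 0 → A *ᵥ v = 0)
    {v : Fin d → ℝ} (hv : P *ᵥ v = v) : singVal A k * norm2 v ≤ norm2 (A *ᵥ v) := by
  obtain rfl | hv0 := eq_or_ne v 0
  · simp [norm2]
  have hpos : 0 < norm2 v := (norm2_nonneg v).lt_of_ne' (mt norm2_eq_zero.1 hv0)
  rw [← le_div_iff₀ hpos]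
  refine Real.sSup_le ?_ (div_nonneg (norm2_nonneg _) hpos.le)
  rintro r ⟨E, hE, rfl⟩
  obtain ⟨a, s, hs, hmem, hne⟩ := exists_smul_add_mem_ne_zero (S := LinearMap.ker P.mulVecLin)
    (T := E) (v := v) (by simpa [hv] using hv0) (by rw [hE]; have := hP.finrank_ker; omega)
  have hs' : P *ᵥ s = 0 := hs
  set r := sInf {s | ∃ v ∈ E, norm2 v = 1 ∧ s = norm2 (A *ᵥ v)} with hr
  have hbdd : ∀ x ∈ {s | ∃ v ∈ E, norm2 v = 1 ∧ s = norm2 (A *ᵥ v)}, 0 ≤ x := by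
    rintro _ ⟨w, -, -, rfl⟩
    exact norm2_nonneg _
  have hr0 : 0 ≤ r := Real.sInf_nonneg hbdd
  have hepos : 0 < norm2 (a • v + s) :=
    (norm2_nonneg _).lt_of_ne' (mt norm2_eq_zero.1 hne)
  have hre : r * norm2 (a • v + s) ≤ |a| * norm2 (A *ᵥ v) := by
    have h : r ≤ norm2 (A *ᵥ ((norm2 (a • v + s))⁻¹ • (a • v + s))) :=
      csInf_le ⟨0, hbdd⟩ ⟨_, E.smul_mem _ hmem, norm2_inv_smul hne, rfl⟩
    rw [mulVec_smul, norm2_smul, abs_of_nonneg (inv_nonneg.2 hepos.le), mulVec_add,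
      hker s hs', add_zero, mulVec_smul, norm2_smul, inv_mul_eq_div, le_div_iff₀ hepos] at h
    exact h
  have hav : |a| * norm2 v ≤ norm2 (a • v + s) := by
    have h := hP.norm2_mulVec_le (a • v + s)
    rwa [mulVec_add, hs', add_zero, mulVec_smul, hv, norm2_smul] at h
  rw [le_div_iff₀ hpos]
  obtain rfl | ha := eq_or_ne a 0
  · have : r = 0 := by
      rw [abs_zero, zero_mul] at hre
      exact le_antisymm (nonpos_of_mul_nonpos_left hre hepos) hr0
    rw [this, zero_mul]
    exact norm2_nonneg _
  · refine le_of_mul_le_mul_left ?_ (abs_pos.2 ha)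
    calc |a| * (r * norm2 v) = r * (|a| * norm2 v) := by ring
      _ ≤ r * norm2 (a • v + s) := by gcongr
      _ ≤ _ := hre

theorem IsTopKProj.norm2_mulVec_le_of_ker (hQ : IsTopKProj A k Q) (hP : IsProjOfRank P k) {z : ℝ}
    (hz : 0 ≤ z) (hA : ∀ v, P *ᵥ v = 0 → norm2 (A *ᵥ v) ≤ z * norm2 v) {w : Fin d → ℝ}
    (hw : Q *ᵥ w = 0) : norm2 (A *ᵥ w) ≤ z * norm2 w := by
  obtain rfl | hw0 := eq_or_ne w 0
  · simp [norm2]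
  obtain ⟨a, q, hq, hmem, hne⟩ := exists_smul_add_mem_ne_zero
    (S := LinearMap.range Q.mulVecLin) (T := LinearMap.ker P.mulVecLin) (v := w)
    (by rw [hQ.1.mem_range_iff, hw]; exact hw0.symm)
    (by rw [hQ.1.finrank_range, hP.finrank_ker])
  rw [hQ.1.mem_range_iff] at hq
  have ht := pow_le_pow_left₀ (norm2_nonneg _) (hA _ hmem) 2
  have htpos := dotProduct_self_pos hne
  have hqw := hQ.1.dotProduct_eq_zero hq hw
  have hAqw := hQ.mulVec_dotProduct_mulVec_eq_zero hq hw
  have hR := hQ.mulVec_dotProduct_self_mul_le hq hw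
  refine (sq_le_sq₀ (norm2_nonneg _) (mul_nonneg hz (norm2_nonneg w))).1 ?_
  rw [mul_pow, norm2_sq, norm2_sq] at ht ⊢
  simp only [mulVec_add, mulVec_smul, add_dotProduct, dotProduct_add, smul_dotProduct,
    dotProduct_smul, smul_eq_mul, dotProduct_comm w q, hqw,
    dotProduct_comm (A *ᵥ w) (A *ᵥ q), hAqw, mul_zero, add_zero, zero_add] at ht htpos
  refine le_of_mul_le_mul_right ?_ htpos
  nlinarith [mul_le_mul_of_nonneg_left ht (dotProduct_self_nonneg w)]

theorem IsTopKProj.le_norm2_mulVec_of_range (hQ : IsTopKProj A k Q) (hP : IsProjOfRank P k) {σ : ℝ}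
    (hσ : 0 ≤ σ) (hA : ∀ v, P *ᵥ v = v → σ * norm2 v ≤ norm2 (A *ᵥ v)) {u : Fin d → ℝ}
    (hu : Q *ᵥ u = u) : σ * norm2 u ≤ norm2 (A *ᵥ u) := by
  obtain rfl | hu0 := eq_or_ne u 0
  · simp [norm2]
  obtain ⟨a, w, hw, hmem, hne⟩ := exists_smul_add_mem_ne_zero
    (S := LinearMap.ker Q.mulVecLin) (T := LinearMap.range P.mulVecLin) (v := u)
    (by simpa [hu] using hu0)
    (by rw [hP.finrank_range]; have := hQ.1.finrank_ker; omega)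
  replace hw : Q *ᵥ w = 0 := hw
  have ht := pow_le_pow_left₀ (mul_nonneg hσ (norm2_nonneg _)) (hA _ (hP.mem_range_iff.1 hmem)) 2
  have htpos := dotProduct_self_pos hne
  have huw := hQ.1.dotProduct_eq_zero hu hw
  have hAuw := hQ.mulVec_dotProduct_mulVec_eq_zero hu hw
  have hR := hQ.mulVec_dotProduct_self_mul_le hu hw
  refine (sq_le_sq₀ (mul_nonneg hσ (norm2_nonneg _)) (norm2_nonneg _)).1 ?_
  rw [mul_pow, norm2_sq, norm2_sq] at ht ⊢
  simp only [mulVec_add, mulVec_smul, add_dotProduct, dotProduct_add, smul_dotProduct,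
    dotProduct_smul, smul_eq_mul, dotProduct_comm w u, huw,
    dotProduct_comm (A *ᵥ w) (A *ᵥ u), hAuw, mul_zero, add_zero, zero_add] at ht htpos
  refine le_of_mul_le_mul_right ?_ htpos
  nlinarith [mul_le_mul_of_nonneg_left ht (dotProduct_self_nonneg u)]

theorem IsTopKProj.norm2_mulVec_mulVec_le (hQ : IsTopKProj A k Q) (w : Fin d → ℝ) :
    norm2 (A *ᵥ Q *ᵥ w) ≤ norm2 (A *ᵥ w) := by
  have h := hQ.mulVec_dotProduct_mulVec_eq_zero (hQ.1.mulVec_mulVec w)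
    (w := w - Q *ᵥ w) (by rw [mulVec_sub, hQ.1.mulVec_mulVec, sub_self])
  refine (sq_le_sq₀ (norm2_nonneg _) (norm2_nonneg _)).1 ?_
  rw [norm2_sq, norm2_sq]
  have hsub := dotProduct_self_nonneg (A *ᵥ w - A *ᵥ Q *ᵥ w)
  simp only [mulVec_sub, dotProduct_sub, sub_dotProduct,
    dotProduct_comm (A *ᵥ w) (A *ᵥ Q *ᵥ w)] at h hsub
  linarith

theorem specNorm_sub_le_of_proj {l : ℕ} (hP : IsProjOfRank P k) (hQ : IsProjOfRank Q l) {a b : ℝ}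
    (ha : 0 ≤ a) (hb : 0 ≤ b) (hPQ : ∀ w, Q *ᵥ w = 0 → norm2 (P *ᵥ w) ≤ a * norm2 w)
    (hQP : ∀ w, P *ᵥ w = 0 → norm2 (Q *ᵥ w) ≤ b * norm2 w) : specNorm (P - Q) ≤ a + b := by
  refine specNorm_le (add_nonneg ha hb) fun v hv => ?_
  have hcompl : norm2 (v - P *ᵥ v) ≤ 1 := by
    rw [← sq_le_one_iff₀ (norm2_nonneg _), norm2_sq]
    have h1 : v ⬝ᵥ v = 1 := by rw [← norm2_sq, hv, one_pow]
    have h2 : P *ᵥ v ⬝ᵥ P *ᵥ v = P *ᵥ v ⬝ᵥ v := by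
      rw [dotProduct_mulVec_of_transpose_eq hP.1, hP.mulVec_mulVec]
    have h3 := dotProduct_self_nonneg (P *ᵥ v)
    simp only [dotProduct_sub, sub_dotProduct, dotProduct_comm v (P *ᵥ v)]
    linarith
  have h1 : norm2 (Q *ᵥ (v - P *ᵥ v)) ≤ b := by
    refine (hQP _ (by rw [mulVec_sub, hP.mulVec_mulVec, sub_self])).trans ?_
    exact mul_le_of_le_one_right hb hcompl
  set y := P *ᵥ v - Q *ᵥ P *ᵥ v with hy
  have hQy : Q *ᵥ y = 0 := by rw [hy, mulVec_sub, hQ.mulVec_mulVec, sub_self]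
  have h2 : norm2 y ≤ a := by
    have hyy : y ⬝ᵥ y = P *ᵥ y ⬝ᵥ v := by
      rw [← dotProduct_mulVec_of_transpose_eq hP.1]
      nth_rw 2 [hy]
      rw [dotProduct_sub, dotProduct_mulVec_of_transpose_eq hQ.1, hQy, zero_dotProduct, sub_zero]
    have h := dotProduct_le_norm2_mul_norm2 (P *ᵥ y) v
    rw [← hyy, ← norm2_sq, hv, mul_one] at h
    nlinarith [hPQ y hQy, norm2_nonneg y]
  have heq : (P - Q) *ᵥ v = y - Q *ᵥ (v - P *ᵥ v) := by
    rw [hy, sub_mulVec, mulVec_sub]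
    abel
  rw [heq]
  exact (norm2_sub_le _ _).trans (add_le_add h2 h1)

end Projection

/-- spectral-norm perturbation bound for the top-`k` right singular
subspace, when `X = Y + Z`, `Y` has rank `k`, and the row space of `Y` is
orthogonal to the row space of `Z` (i.e. `Y Zᵀ = 0`). -/
theorem stmt3 (n d k : ℕ) (X Y Z : Matrix (Fin n) (Fin d) ℝ)
    (PV PVhat : Matrix (Fin d) (Fin d) ℝ)
    (hXYZ : X = Y + Z) (hrank : Y.rank = k) (horth : Y * Z.transpose = 0)
    (hPV : IsTopKProj Y k PV) (hPVhat : IsTopKProj X k PVhat)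
    (hgap : 2 * specNorm Z ^ 2 ≤ singVal Y k ^ 2) :
    specNorm (PV - PVhat) ≤ 4 * specNorm Z / singVal Y k := by
  have hYZ : Y * Zᵀ = 0 := horth
  have hP := hPV.1
  have hQ := hPVhat.1
  have hkerY := hPV.mulVec_eq_zero_iff hrank
  have hYP := hPV.mul_eq_self hrank
  have hZP : Z * PV = 0 := by
    have h : PV * Zᵀ = 0 := by
      refine Matrix.ext_of_mulVec_single fun i => ?_
      rw [← Matrix.mulVec_mulVec, zero_mulVec, hkerY, Matrix.mulVec_mulVec, hYZ, zero_mulVec]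
    simpa [hP.1] using congrArg transpose h
  have hz := specNorm_nonneg Z
  have hXker : ∀ v, PV *ᵥ v = 0 → norm2 (X *ᵥ v) ≤ specNorm Z * norm2 v := by
    intro v hv
    rw [hXYZ, add_mulVec, (hkerY v).1 hv, zero_add]
    exact norm2_mulVec_le_specNorm Z v
  have hσY : ∀ v, PV *ᵥ v = v → singVal Y k * norm2 v ≤ norm2 (Y *ᵥ v) :=
    fun v => singVal_mul_norm2_le hP fun v => (hkerY v).1
  have hXrange : ∀ v, PV *ᵥ v = v → singVal Y k * norm2 v ≤ norm2 (X *ᵥ v) := by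
    intro v hv
    have : Z *ᵥ v = 0 := by rw [← hv, Matrix.mulVec_mulVec, hZP, zero_mulVec]
    rw [hXYZ, add_mulVec, this, add_zero]
    exact hσY v hv
  obtain hσ | hσ := (singVal_nonneg Y k).eq_or_lt
  · have hz0 : specNorm Z = 0 := by
      rw [← hσ] at hgap
      nlinarith
    have hZ : ∀ v, Z *ᵥ v = 0 := fun v => norm2_eq_zero.1 <|
      le_antisymm (by simpa [hz0] using norm2_mulVec_le_specNorm Z v) (norm2_nonneg _)
    have hXY : X = Y := by
      refine Matrix.ext_of_mulVec_single fun i => ?_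
      rw [hXYZ, add_mulVec, hZ, add_zero]
    have hPQ : PV = PVhat := hP.eq_of_mulVec_eq_zero_iff hQ fun v =>
      (hkerY v).trans ((hXY ▸ hPVhat).mulVec_eq_zero_iff hrank v).symm
    rw [hPQ, sub_self, ← hσ, div_zero]
    exact specNorm_le le_rfl (by simp [norm2])
  have hPw : ∀ w, PVhat *ᵥ w = 0 →
      norm2 (PV *ᵥ w) ≤ 2 * specNorm Z / singVal Y k * norm2 w := by
    intro w hw
    rw [div_mul_eq_mul_div, le_div_iff₀' hσ]
    have h1 := hPVhat.norm2_mulVec_le_of_ker hP hz hXker hw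
    have h2 := norm2_mulVec_le_specNorm Z w
    have h3 := hσY _ (hP.mulVec_mulVec w)
    have h4 := norm2_sub_le (X *ᵥ w) (Z *ᵥ w)
    rw [Matrix.mulVec_mulVec, hYP] at h3
    rw [← sub_mulVec, hXYZ, add_sub_cancel_right, ← hXYZ] at h4
    linarith
  have hQw : ∀ w, PV *ᵥ w = 0 →
      norm2 (PVhat *ᵥ w) ≤ specNorm Z / singVal Y k * norm2 w := by
    intro w hw
    rw [div_mul_eq_mul_div, le_div_iff₀' hσ]
    exact (hPVhat.le_norm2_mulVec_of_range hP hσ.le hXrange (hQ.mulVec_mulVec w)).trans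
      ((hPVhat.norm2_mulVec_mulVec_le w).trans (hXker w hw))
  refine (specNorm_sub_le_of_proj hP hQ (by positivity) (by positivity) hPw hQw).trans ?_
  rw [← add_div]
  gcongr
  linarith
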